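/- arXiv:2304.11427 — 2 statements merged into one kernel-verified Lean document; each statement's English description precedes it below -/
import Mathlib

section
/- Let d, m ≥ 1, let Ω₀, Ω ⊆ ℝᵈ be open, and let 𝒢 : Ω₀ → Ω be a twice continuously differentiable diffeomorphism with deformation gradient G(X) = ∇̄𝒢(X) invertible for all X ∈ Ω₀. Let F : ℝᵐ → ℝ^{m×d} be continuously differentiable, S : ℝᵐ → ℝᵐ, and let U : Ω → ℝᵐ be differentiable. Define the transformed solution Ū = U∘𝒢 : Ω₀ → ℝᵐ, the transformed flux F̄(W̄; Θ) = det(Θ) · F(W̄) Θ⁻ᵀ, and the transformed source S̄(W̄; q) = q · S(W̄). Then U satisfies the system of conservation laws ∇·F(U) = S(U) on Ω if and only if Ū satisfies the transformed system ∇̄·F̄(Ū; G) = S̄(Ū; det G) on Ω₀. -/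
open Matrix

/-- The Jacobian (deformation gradient) of a map `𝒢 : ℝᵈ → ℝᵈ` at `X`:
`G(X)_{ij} = ∂𝒢_i/∂X_j`. -/
noncomputable def defGrad {d : ℕ} (𝒢 : (Fin d → ℝ) → (Fin d → ℝ)) (X : Fin d → ℝ) :
    Matrix (Fin d) (Fin d) ℝ :=
  fun i j => fderiv ℝ 𝒢 X (Pi.single j 1) i

/-- The row-wise divergence of a matrix-valued field `M : ℝᵈ → ℝ^{m×d}`:
`(∇·M)_i(x) = ∑ⱼ ∂M_{ij}/∂xⱼ(x)`. -/
noncomputable def rowDiv {d m : ℕ} (M : (Fin d → ℝ) → Matrix (Fin m) (Fin d) ℝ)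
    (x : Fin d → ℝ) : Fin m → ℝ :=
  fun i => ∑ j : Fin d, fderiv ℝ (fun y => M y i j) x (Pi.single j 1)

/-- The transformed flux `F̄(W̄; Θ) = det(Θ) F(W̄) Θ⁻ᵀ`. -/
noncomputable def transFlux {d m : ℕ} (F : (Fin m → ℝ) → Matrix (Fin m) (Fin d) ℝ)
    (W : Fin m → ℝ) (Θ : Matrix (Fin d) (Fin d) ℝ) : Matrix (Fin m) (Fin d) ℝ :=
  Θ.det • (F W * Θ⁻¹ᵀ)

/-- The transformed source `S̄(W̄; q) = q S(W̄)`. -/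
def transSource {m : ℕ} (S : (Fin m → ℝ) → (Fin m → ℝ)) (W : Fin m → ℝ) (q : ℝ) :
    Fin m → ℝ :=
  q • S W

section JacobiFormula

variable {E : Type*} [NormedAddCommGroup E] [NormedSpace ℝ E]
  {n : Type*} [Fintype n] [DecidableEq n]

/-- **Jacobi's formula** for the derivative of a determinant. -/
theorem hasFDerivAt_matrix_det {M : E → Matrix n n ℝ} {M' : n → n → E →L[ℝ] ℝ} {x : E}
    (hM : ∀ i j, HasFDerivAt (fun y => M y i j) (M' i j) x) :
    HasFDerivAt (fun y => (M y).det) (∑ i, ∑ j, (M x).adjugate j i • M' i j) x := by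
  let D : ContinuousMultilinearMap ℝ (fun _ : n => n → ℝ) ℝ :=
    { (detRowAlternating (n := n) (R := ℝ)).toMultilinearMap with
      cont := Continuous.matrix_det (A := fun B : n → n → ℝ => (B : Matrix n n ℝ))
        continuous_id }
  have hD (B : n → n → ℝ) : D B = Matrix.det (B : Matrix n n ℝ) := rfl
  have hrow (i : n) : HasFDerivAt (fun y => (M y i : n → ℝ))
      (ContinuousLinearMap.pi fun j => M' i j) x :=
    hasFDerivAt_pi.2 (hM i)
  have h := HasFDerivAt.multilinear_comp D hrow
  refine h.congr_fderiv ?_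
  ext v
  simp only [_root_.sum_apply, _root_.smul_apply,
    ContinuousLinearMap.comp_apply, ContinuousMultilinearMap.toContinuousLinearMap_apply]
  refine Finset.sum_congr rfl fun i _ => ?_
  rw [hD]
  change ((M x).updateRow i fun j => M' i j v).det = _
  rw [← cramer_transpose_apply, cramer_eq_adjugate_mulVec, ← adjugate_transpose]
  simp [mulVec, dotProduct]

theorem DifferentiableAt.matrix_det {M : E → Matrix n n ℝ} {x : E}
    (hM : ∀ i j, DifferentiableAt ℝ (fun y => M y i j) x) :
    DifferentiableAt ℝ (fun y => (M y).det) x :=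
  (hasFDerivAt_matrix_det fun i j => (hM i j).hasFDerivAt).differentiableAt

theorem DifferentiableAt.matrix_adjugate_apply {M : E → Matrix n n ℝ} {x : E}
    (hM : ∀ i j, DifferentiableAt ℝ (fun y => M y i j) x) (i j : n) :
    DifferentiableAt ℝ (fun y => (M y).adjugate i j) x := by
  simp only [adjugate_apply]
  refine DifferentiableAt.matrix_det fun k l => ?_
  by_cases hk : k = j
  · simp [updateRow_apply, hk]
  · simpa [updateRow_apply, hk] using hM k l

end JacobiFormula

section Piola

variable {d : ℕ} {𝒢 : (Fin d → ℝ) → (Fin d → ℝ)} {X : Fin d → ℝ}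

theorem hasFDerivAt_defGrad_apply (h : ContDiffAt ℝ 2 𝒢 X) (i j : Fin d) :
    HasFDerivAt (fun Y => defGrad 𝒢 Y i j)
      ((ContinuousLinearMap.proj (R := ℝ) (φ := fun _ : Fin d => ℝ) i).comp
        ((fderiv ℝ (fderiv ℝ 𝒢) X).flip (Pi.single j 1))) X := by
  have h1 : DifferentiableAt ℝ (fderiv ℝ 𝒢) X :=
    (h.fderiv_right (m := 1) (by norm_num)).differentiableAt (by norm_num)
  have h2 := h1.hasFDerivAt.clm_apply (hasFDerivAt_const (Pi.single j (1 : ℝ) : Fin d → ℝ) X)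
  have h3 := hasFDerivAt_pi'.1 h2 i
  refine h3.congr_fderiv ?_
  ext v
  simp

theorem differentiableAt_defGrad_apply (h : ContDiffAt ℝ 2 𝒢 X) (i j : Fin d) :
    DifferentiableAt ℝ (fun Y => defGrad 𝒢 Y i j) X :=
  (hasFDerivAt_defGrad_apply h i j).differentiableAt

theorem fderiv_defGrad_comm (h : ContDiffAt ℝ 2 𝒢 X) (i j k : Fin d) :
    fderiv ℝ (fun Y => defGrad 𝒢 Y i j) X (Pi.single k 1) =
      fderiv ℝ (fun Y => defGrad 𝒢 Y i k) X (Pi.single j 1) := by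
  rw [(hasFDerivAt_defGrad_apply h i j).fderiv, (hasFDerivAt_defGrad_apply h i k).fderiv]
  have hs := (h.isSymmSndFDerivAt (by simp)).eq (Pi.single k 1) (Pi.single j 1)
  simp [hs]

/-- **Piola identity**: the cofactor matrix of a `C²` deformation gradient is row-wise
divergence free. -/
theorem sum_fderiv_adjugate_defGrad (h : ContDiffAt ℝ 2 𝒢 X) (hG : IsUnit (defGrad 𝒢 X))
    (k : Fin d) :
    ∑ j, fderiv ℝ (fun Y => (defGrad 𝒢 Y).adjugate j k) X (Pi.single j 1) = 0 := by
  have hdG := differentiableAt_defGrad_apply h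
  have hdA := DifferentiableAt.matrix_adjugate_apply hdG
  set v : Fin d → ℝ := fun k =>
    ∑ j, fderiv ℝ (fun Y => (defGrad 𝒢 Y).adjugate j k) X (Pi.single j 1) with hv
  suffices hv0 : v = 0 from congrFun hv0 k
  refine vecMul_injective_of_isUnit hG ?_
  simp only [zero_vecMul]
  ext l
  have key (j : Fin d) :
      ∑ k, ((defGrad 𝒢 X).adjugate j k *
            fderiv ℝ (fun Y => defGrad 𝒢 Y k l) X (Pi.single j 1) +
          defGrad 𝒢 X k l *
            fderiv ℝ (fun Y => (defGrad 𝒢 Y).adjugate j k) X (Pi.single j 1)) =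
        if j = l then fderiv ℝ (fun Y => (defGrad 𝒢 Y).det) X (Pi.single l 1) else 0 := by
    have e : (fun Y => ∑ k, (defGrad 𝒢 Y).adjugate j k * defGrad 𝒢 Y k l) =
        fun Y => if j = l then (defGrad 𝒢 Y).det else 0 := by
      ext Y
      rw [← mul_apply, adjugate_mul, Matrix.smul_apply, one_apply]
      simp
    have hs : HasFDerivAt (fun Y => ∑ k, (defGrad 𝒢 Y).adjugate j k * defGrad 𝒢 Y k l) _ X :=
      HasFDerivAt.fun_sum (u := Finset.univ) fun k _ =>
        (hdA j k).hasFDerivAt.mul (hdG k l).hasFDerivAt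
    have e' := hs.fderiv
    rw [e] at e'
    replace e' := congrArg (fun f => f (Pi.single j 1)) e'.symm
    simp only [_root_.sum_apply, _root_.add_apply,
      _root_.smul_apply, smul_eq_mul] at e'
    rw [e']
    split_ifs with hjl
    · rw [hjl]
    · simp
  have hsum := Finset.sum_congr rfl fun j (_ : j ∈ Finset.univ) => key j
  rw [Finset.sum_ite_eq' Finset.univ l] at hsum
  simp only [Finset.mem_univ, if_true, Finset.sum_add_distrib] at hsum
  rw [(hasFDerivAt_matrix_det fun i j => (hdG i j).hasFDerivAt).fderiv] at hsum
  simp only [_root_.sum_apply, _root_.smul_apply, smul_eq_mul] at hsum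
  have hc : ∑ j, ∑ k, (defGrad 𝒢 X).adjugate j k *
        fderiv ℝ (fun Y => defGrad 𝒢 Y k l) X (Pi.single j 1) =
      ∑ i, ∑ j, (defGrad 𝒢 X).adjugate j i *
        fderiv ℝ (fun Y => defGrad 𝒢 Y i j) X (Pi.single l 1) := by
    rw [Finset.sum_comm]
    exact Finset.sum_congr rfl fun i _ => Finset.sum_congr rfl fun j _ => by
      rw [fderiv_defGrad_comm h i l j]
  rw [hc, add_eq_left, Finset.sum_comm] at hsum
  simpa [vecMul, dotProduct, hv, Finset.mul_sum, mul_comm] using hsum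

/-- Divergence form of the Piola transform: pulling back a matrix field by the cofactor matrix
multiplies its divergence by the Jacobian determinant. -/
theorem rowDiv_mul_adjugate_transpose {m : ℕ} {P : (Fin d → ℝ) → Matrix (Fin m) (Fin d) ℝ}
    (h : ContDiffAt ℝ 2 𝒢 X) (hG : IsUnit (defGrad 𝒢 X))
    (hP : ∀ i j, DifferentiableAt ℝ (fun y => P y i j) (𝒢 X)) :
    rowDiv (fun Y => P (𝒢 Y) * (defGrad 𝒢 Y).adjugateᵀ) X =
      (defGrad 𝒢 X).det • rowDiv P (𝒢 X) := by
  have hdA := DifferentiableAt.matrix_adjugate_apply (differentiableAt_defGrad_apply h)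
  have h𝒢 : DifferentiableAt ℝ 𝒢 X := h.differentiableAt (by norm_num)
  have hchain (i : Fin m) (k j : Fin d) :
      fderiv ℝ (fun Y => P (𝒢 Y) i k) X (Pi.single j 1) =
        ∑ l, defGrad 𝒢 X l j * fderiv ℝ (fun y => P y i k) (𝒢 X) (Pi.single l 1) := by
    have hc : HasFDerivAt (fun Y => P (𝒢 Y) i k) _ X :=
      (hP i k).hasFDerivAt.comp X h𝒢.hasFDerivAt
    rw [hc.fderiv, ContinuousLinearMap.comp_apply]
    conv_lhs => rw [pi_eq_sum_univ' (fderiv ℝ 𝒢 X (Pi.single j 1)), map_sum]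
    simp [defGrad, Pi.single]
  ext i
  have hterm (j : Fin d) :
      fderiv ℝ (fun Y => (P (𝒢 Y) * (defGrad 𝒢 Y).adjugateᵀ) i j) X (Pi.single j 1) =
        ∑ k, (P (𝒢 X) i k *
            fderiv ℝ (fun Y => (defGrad 𝒢 Y).adjugate j k) X (Pi.single j 1) +
          (defGrad 𝒢 X).adjugate j k *
            ∑ l, defGrad 𝒢 X l j * fderiv ℝ (fun y => P y i k) (𝒢 X) (Pi.single l 1)) := by
    have hs : HasFDerivAt (fun Y => ∑ k, P (𝒢 Y) i k * (defGrad 𝒢 Y).adjugate j k) _ X :=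
      HasFDerivAt.fun_sum (u := Finset.univ) fun k _ =>
        ((hP i k).comp X h𝒢).hasFDerivAt.mul (hdA j k).hasFDerivAt
    simp only [mul_apply, transpose_apply]
    rw [hs.fderiv]
    simp only [_root_.sum_apply, _root_.add_apply,
      _root_.smul_apply, smul_eq_mul, ← hchain]
    rfl
  have hdet (l k : Fin d) : ∑ j, defGrad 𝒢 X l j * (defGrad 𝒢 X).adjugate j k =
      if l = k then (defGrad 𝒢 X).det else 0 := by
    rw [← mul_apply, mul_adjugate, Matrix.smul_apply, one_apply]
    simp
  simp only [rowDiv, hterm, Finset.sum_add_distrib, Pi.smul_apply, smul_eq_mul]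
  rw [Finset.sum_comm]
  simp only [← Finset.mul_sum, sum_fderiv_adjugate_defGrad h hG, mul_zero,
    Finset.sum_const_zero, zero_add]
  rw [Finset.sum_comm, Finset.mul_sum]
  refine Finset.sum_congr rfl fun k _ => ?_
  calc ∑ j, (defGrad 𝒢 X).adjugate j k *
          ∑ l, defGrad 𝒢 X l j * fderiv ℝ (fun y => P y i k) (𝒢 X) (Pi.single l 1)
      = ∑ l, (∑ j, defGrad 𝒢 X l j * (defGrad 𝒢 X).adjugate j k) *
          fderiv ℝ (fun y => P y i k) (𝒢 X) (Pi.single l 1) := by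
        simp only [Finset.mul_sum, Finset.sum_mul]
        rw [Finset.sum_comm]
        exact Finset.sum_congr rfl fun l _ => Finset.sum_congr rfl fun j _ => by ring
    _ = (defGrad 𝒢 X).det * fderiv ℝ (fun y => P y i k) (𝒢 X) (Pi.single k 1) := by
        simp [hdet]

end Piola

theorem rowDiv_congr_of_eventuallyEq {d m : ℕ} {M N : (Fin d → ℝ) → Matrix (Fin m) (Fin d) ℝ}
    {x : Fin d → ℝ} (h : M =ᶠ[nhds x] N) : rowDiv M x = rowDiv N x := by
  ext i
  refine Finset.sum_congr rfl fun j _ => ?_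
  have hij : (fun y => M y i j) =ᶠ[nhds x] fun y => N y i j := h.mono fun y hy => by
    simp only [hy]
  rw [hij.fderiv_eq]

theorem transFlux_eq_mul_adjugate_transpose {d m : ℕ}
    (F : (Fin m → ℝ) → Matrix (Fin m) (Fin d) ℝ) (W : Fin m → ℝ)
    {Θ : Matrix (Fin d) (Fin d) ℝ} (hΘ : IsUnit Θ) :
    transFlux F W Θ = F W * Θ.adjugateᵀ := by
  have hdet : Θ.det ≠ 0 := ((isUnit_iff_isUnit_det Θ).1 hΘ).ne_zero
  rw [transFlux, inv_def, transpose_smul, Matrix.mul_smul, smul_smul, Ring.inverse_eq_inv',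
    mul_inv_cancel₀ hdet, one_smul]

/-- **Reference-domain transformation of a system of conservation laws**: for a C²
diffeomorphism `𝒢 : Ω₀ → Ω` with invertible deformation gradient `G`, a C¹ flux `F`,
a source `S`, and a differentiable state `U`, the physical conservation law
`∇·F(U) = S(U)` on `Ω` holds iff the transformed conservation law
`∇̄·F̄(Ū; G) = S̄(Ū; det G)` holds on `Ω₀`, where `Ū = U∘𝒢`. -/
theorem transformed_conservation_law {d m : ℕ} (hd : 1 ≤ d) (hm : 1 ≤ m)
    (Ω₀ Ω : Set (Fin d → ℝ)) (hΩ₀ : IsOpen Ω₀) (hΩ : IsOpen Ω)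
    (𝒢 : (Fin d → ℝ) → (Fin d → ℝ)) (hbij : Set.BijOn 𝒢 Ω₀ Ω)
    (h𝒢 : ContDiffOn ℝ 2 𝒢 Ω₀)
    (hG : ∀ X ∈ Ω₀, IsUnit (defGrad 𝒢 X))
    (F : (Fin m → ℝ) → Matrix (Fin m) (Fin d) ℝ)
    (hF : ContDiff ℝ 1 (fun W (i : Fin m) (j : Fin d) => F W i j))
    (S : (Fin m → ℝ) → (Fin m → ℝ))
    (U : (Fin d → ℝ) → (Fin m → ℝ)) (hU : DifferentiableOn ℝ U Ω) :
    (∀ x ∈ Ω, rowDiv (fun y => F (U y)) x = S (U x)) ↔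
    (∀ X ∈ Ω₀,
      rowDiv (fun Y => transFlux F (U (𝒢 Y)) (defGrad 𝒢 Y)) X =
        transSource S (U (𝒢 X)) (defGrad 𝒢 X).det) := by
  have hsource : ∀ X ∈ Ω₀,
      (rowDiv (fun Y => transFlux F (U (𝒢 Y)) (defGrad 𝒢 Y)) X =
          transSource S (U (𝒢 X)) (defGrad 𝒢 X).det ↔
        rowDiv (fun y => F (U y)) (𝒢 X) = S (U (𝒢 X))) := by
    intro X hX
    have hdet : (defGrad 𝒢 X).det ≠ 0 := ((isUnit_iff_isUnit_det _).1 (hG X hX)).ne_zero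
    have hUX : DifferentiableAt ℝ U (𝒢 X) :=
      hU.differentiableAt (hΩ.mem_nhds (hbij.mapsTo hX))
    have hP (i : Fin m) (j : Fin d) : DifferentiableAt ℝ (fun y => F (U y) i j) (𝒢 X) := by
      have hFU := (hF.differentiable (by norm_num) (U (𝒢 X))).comp (𝒢 X) hUX
      exact differentiableAt_pi.1 (differentiableAt_pi.1 hFU i) j
    have hev : (fun Y => transFlux F (U (𝒢 Y)) (defGrad 𝒢 Y)) =ᶠ[nhds X]
        fun Y => F (U (𝒢 Y)) * (defGrad 𝒢 Y).adjugateᵀ :=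
      Filter.eventually_of_mem (hΩ₀.mem_nhds hX) fun Y hY =>
        transFlux_eq_mul_adjugate_transpose F _ (hG Y hY)
    rw [rowDiv_congr_of_eventuallyEq hev,
      rowDiv_mul_adjugate_transpose (P := fun y => F (U y))
        (h𝒢.contDiffAt (hΩ₀.mem_nhds hX)) (hG X hX) hP, transSource]
    exact smul_right_inj hdet
  constructor
  · intro h X hX
    exact (hsource X hX).2 (h _ (hbij.mapsTo hX))
  · intro h x hx
    obtain ⟨X, hX, rfl⟩ := hbij.surjOn hx
    exact (hsource X hX).1 (h X hX)
end

section
/- Let d, m ≥ 1, let Ω₀ ⊆ ℝᵈ be open and measurable, and let 𝒢 : Ω₀ → ℝᵈ be continuously differentiable and injective on Ω₀ with det G(X) > 0 for all X ∈ Ω₀, where G(X) = ∇̄𝒢(X), so Ω := 𝒢(Ω₀) is open. Let F̃ : Ω → ℝ^{m×d} be continuous and let ψ : Ω → ℝᵐ be continuously differentiable, and suppose x ↦ F̃(x) : ∇ψ(x) is Lebesgue integrable on Ω. Then X ↦ det(G(X)) · (F̃(𝒢(X)) G(X)⁻ᵀ) : ∇̄(ψ∘𝒢)(X) is integrable on Ω₀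 and ∫_{Ω₀} det(G(X)) (F̃(𝒢(X)) G(X)⁻ᵀ) : ∇̄(ψ∘𝒢)(X) dX = ∫_{Ω} F̃(x) : ∇ψ(x) dx. That is, the volume term of the transformed weak formulation on the reference domain equals the corresponding volume term of the physical weak formulation. -/
open Matrix MeasureTheory

/-- The `m × d` Jacobian matrix `∇ψ(x)_{ij} = ∂ψ_i/∂x_j(x)` of `ψ : ℝᵈ → ℝᵐ`. -/
noncomputable def jac {d m : ℕ} (ψ : (Fin d → ℝ) → (Fin m → ℝ)) (x : Fin d → ℝ) :
    Matrix (Fin m) (Fin d) ℝ :=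
  fun i j => fderiv ℝ ψ x (Pi.single j 1) i

/-- The Frobenius inner product `A : B = ∑ᵢ ∑ⱼ A_{ij} B_{ij}`. -/
def frob {d m : ℕ} (A B : Matrix (Fin m) (Fin d) ℝ) : ℝ :=
  ∑ i : Fin m, ∑ j : Fin d, A i j * B i j

theorem jac_eq_toMatrix' {d m : ℕ} (ψ : (Fin d → ℝ) → (Fin m → ℝ)) (x : Fin d → ℝ) :
    jac ψ x = LinearMap.toMatrix' (fderiv ℝ ψ x : (Fin d → ℝ) →ₗ[ℝ] (Fin m → ℝ)) := by
  ext i j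
  simp [jac, LinearMap.toMatrix'_apply]

theorem det_defGrad {d : ℕ} (𝒢 : (Fin d → ℝ) → (Fin d → ℝ)) (X : Fin d → ℝ) :
    (defGrad 𝒢 X).det = (fderiv ℝ 𝒢 X).det := by
  rw [show defGrad 𝒢 X = jac 𝒢 X from rfl, jac_eq_toMatrix', LinearMap.det_toMatrix']

theorem jac_comp {d m : ℕ} {ψ : (Fin d → ℝ) → (Fin m → ℝ)} {𝒢 : (Fin d → ℝ) → (Fin d → ℝ)}
    {X : Fin d → ℝ} (hψ : DifferentiableAt ℝ ψ (𝒢 X)) (h𝒢 : DifferentiableAt ℝ 𝒢 X) :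
    jac (fun Y => ψ (𝒢 Y)) X = jac ψ (𝒢 X) * defGrad 𝒢 X := by
  rw [show defGrad 𝒢 X = jac 𝒢 X from rfl, jac_eq_toMatrix', jac_eq_toMatrix', jac_eq_toMatrix',
    fderiv_fun_comp X hψ h𝒢, ContinuousLinearMap.toLinearMap_comp, LinearMap.toMatrix'_comp]

theorem frob_eq_trace {d m : ℕ} (A B : Matrix (Fin m) (Fin d) ℝ) :
    frob A B = (A * Bᵀ).trace := by
  simp [frob, Matrix.trace, Matrix.mul_apply]

theorem frob_mul_inv_transpose_mul {d m : ℕ} (A B : Matrix (Fin m) (Fin d) ℝ)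
    {G : Matrix (Fin d) (Fin d) ℝ} (hG : G.det ≠ 0) :
    frob (A * G⁻¹ᵀ) (B * G) = frob A B := by
  have hG' : G⁻¹ᵀ * Gᵀ = 1 := by
    rw [← Matrix.transpose_mul, Matrix.mul_nonsing_inv G hG.isUnit, Matrix.transpose_one]
  rw [frob_eq_trace, frob_eq_trace, Matrix.transpose_mul, Matrix.mul_assoc,
    ← Matrix.mul_assoc _ Gᵀ, hG', Matrix.one_mul]

theorem isOpen_image_of_det_defGrad_ne_zero {d : ℕ} {Ω₀ : Set (Fin d → ℝ)} (hΩ₀ : IsOpen Ω₀)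
    {𝒢 : (Fin d → ℝ) → (Fin d → ℝ)} (h𝒢 : ContDiffOn ℝ 1 𝒢 Ω₀)
    (hdet : ∀ X ∈ Ω₀, (defGrad 𝒢 X).det ≠ 0) : IsOpen (𝒢 '' Ω₀) := by
  rw [isOpen_iff_mem_nhds]
  rintro _ ⟨X, hX, rfl⟩
  have hstrict := (h𝒢.contDiffAt (hΩ₀.mem_nhds hX)).hasStrictFDerivAt one_ne_zero
  have hX' : (fderiv ℝ 𝒢 X).det ≠ 0 := det_defGrad 𝒢 X ▸ hdet X hX
  rw [← ContinuousLinearMap.coe_toContinuousLinearEquivOfDetNeZero _ hX'] at hstrict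
  rw [← hstrict.map_nhds_eq_of_equiv]
  exact Filter.image_mem_map (hΩ₀.mem_nhds hX)

/-- **Equality of the volume terms of the physical and transformed weak formulations**:
for a C¹ injective map `𝒢` on an open measurable set `Ω₀` with `det G > 0`, a continuous
matrix field `F̃` and a C¹ test function `ψ` on `Ω = 𝒢(Ω₀)` with `F̃ : ∇ψ` integrable
on `Ω`, the pulled-back integrand `det(G) (F̃∘𝒢 · G⁻ᵀ) : ∇̄(ψ∘𝒢)` is integrable on `Ω₀`
and its integral equals `∫_Ω F̃ : ∇ψ`. -/
theorem transformed_weak_form_volume_term {d m : ℕ} (hd : 1 ≤ d) (hm : 1 ≤ m)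
    (Ω₀ : Set (Fin d → ℝ)) (hΩ₀ : IsOpen Ω₀) (hΩ₀m : MeasurableSet Ω₀)
    (𝒢 : (Fin d → ℝ) → (Fin d → ℝ)) (h𝒢 : ContDiffOn ℝ 1 𝒢 Ω₀)
    (hinj : Set.InjOn 𝒢 Ω₀)
    (hdet : ∀ X ∈ Ω₀, 0 < (defGrad 𝒢 X).det)
    (Ftil : (Fin d → ℝ) → Matrix (Fin m) (Fin d) ℝ)
    (hFtil : ContinuousOn Ftil (𝒢 '' Ω₀))
    (ψ : (Fin d → ℝ) → (Fin m → ℝ)) (hψ : ContDiffOn ℝ 1 ψ (𝒢 '' Ω₀))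
    (hint : IntegrableOn (fun x => frob (Ftil x) (jac ψ x)) (𝒢 '' Ω₀)) :
    IntegrableOn
      (fun X => (defGrad 𝒢 X).det *
        frob (Ftil (𝒢 X) * (defGrad 𝒢 X)⁻¹ᵀ) (jac (fun Y => ψ (𝒢 Y)) X)) Ω₀ ∧
    ∫ X in Ω₀, (defGrad 𝒢 X).det *
        frob (Ftil (𝒢 X) * (defGrad 𝒢 X)⁻¹ᵀ) (jac (fun Y => ψ (𝒢 Y)) X) =
      ∫ x in 𝒢 '' Ω₀, frob (Ftil x) (jac ψ x) := by
  have hopen : IsOpen (𝒢 '' Ω₀) :=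
    isOpen_image_of_det_defGrad_ne_zero hΩ₀ h𝒢 fun X hX => (hdet X hX).ne'
  have hdiff : ∀ X ∈ Ω₀, DifferentiableAt ℝ 𝒢 X := fun X hX =>
    (h𝒢.contDiffAt (hΩ₀.mem_nhds hX)).differentiableAt one_ne_zero
  have hderiv : ∀ X ∈ Ω₀, HasFDerivWithinAt 𝒢 (fderiv ℝ 𝒢 X) Ω₀ X := fun X hX =>
    (hdiff X hX).hasFDerivAt.hasFDerivWithinAt
  have heq : Set.EqOn
      (fun X => |(fderiv ℝ 𝒢 X).det| • frob (Ftil (𝒢 X)) (jac ψ (𝒢 X)))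
      (fun X => (defGrad 𝒢 X).det *
        frob (Ftil (𝒢 X) * (defGrad 𝒢 X)⁻¹ᵀ) (jac (fun Y => ψ (𝒢 Y)) X)) Ω₀ := by
    intro X hX
    have hψX : DifferentiableAt ℝ ψ (𝒢 X) :=
      (hψ.contDiffAt (hopen.mem_nhds (Set.mem_image_of_mem 𝒢 hX))).differentiableAt one_ne_zero
    simp only [jac_comp hψX (hdiff X hX), frob_mul_inv_transpose_mul _ _ (hdet X hX).ne',
      ← det_defGrad, abs_of_pos (hdet X hX), smul_eq_mul]
  constructor
  · exact ((integrableOn_image_iff_integrableOn_abs_det_fderiv_smul volume hΩ₀m hderiv hinj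
      _).1 hint).congr_fun heq hΩ₀m
  · rw [integral_image_eq_integral_abs_det_fderiv_smul volume hΩ₀m hderiv hinj]
    exact (setIntegral_congr_fun hΩ₀m heq).symm
end
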